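/- Let G be an acyclically edge (Δ(G)+2)-critical finite simple graph, and let v be a vertex of degree t with t ≥ 5. Then the number of neighbors of v having degree 2 is at most t − 4. -/

import Mathlib

open SimpleGraph

/-- A proper edge coloring of `G`: distinct edges sharing a vertex get distinct colors. -/
def IsProperEdgeColoring {V : Type*} {α : Type*} (G : SimpleGraph V) (c : Sym2 V → α) : Prop :=
  ∀ e₁ ∈ G.edgeSet, ∀ e₂ ∈ G.edgeSet, e₁ ≠ e₂ → (∃ v, v ∈ e₁ ∧ v ∈ e₂) → c e₁ ≠ c e₂

/-- An acyclic edge coloring: proper, and no cycle of `G` uses at most two colors. -/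
def IsAcyclicEdgeColoring {V : Type*} {α : Type*} (G : SimpleGraph V) (c : Sym2 V → α) : Prop :=
  IsProperEdgeColoring G c ∧
    ∀ (v : V) (w : G.Walk v v), w.IsCycle →
      ¬ ∃ a b : α, ∀ e ∈ w.edges, c e = a ∨ c e = b

/-- `G` has an acyclic edge coloring with `k` colors. -/
def AcyclicEdgeColorable {V : Type*} (G : SimpleGraph V) (k : ℕ) : Prop :=
  ∃ c : Sym2 V → Fin k, IsAcyclicEdgeColoring G c

/-- The acyclic chromatic index: least `k` such that `G` is acyclically edge `k`-colorable. -/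
noncomputable def acyclicChromaticIndex {V : Type*} (G : SimpleGraph V) : ℕ :=
  sInf {k | AcyclicEdgeColorable G k}

/-- `G` is acyclically edge `k`-critical: `G` is not acyclically edge `k`-colorable, but every
proper subgraph of `G` is. -/
def IsAcyclicallyEdgeCritical {V : Type*} (G : SimpleGraph V) (k : ℕ) : Prop :=
  ¬ AcyclicEdgeColorable G k ∧ ∀ H : SimpleGraph V, H < G → AcyclicEdgeColorable H k

section Reachability

variable {V : Type*} {K : SimpleGraph V}

/-- A vertex with at most one neighbor. -/
def IsLeafLike (K : SimpleGraph V) (v : V) : Prop :=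
  ∀ p q, K.Adj v p → K.Adj v q → p = q

lemma mem_of_reachable_of_closed {S : Set V} (hS : ∀ p ∈ S, ∀ q, K.Adj p q → q ∈ S)
    {v z : V} (hv : v ∈ S) (h : K.Reachable v z) : z ∈ S := by
  obtain ⟨p⟩ := h
  induction p with
  | nil => exact hv
  | cons h p ih => exact ih (hS _ hv _ h)

/-- A component of a graph of maximum degree two has at most two vertices of degree at most one. -/
lemma not_reachable_third_leaf
    (hK : ∀ x p q r, K.Adj x p → K.Adj x q → K.Adj x r → p = q ∨ q = r ∨ p = r)
    {v w z : V} (hv : IsLeafLike K v) (hw : IsLeafLike K w) (hz : IsLeafLike K z)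
    (hvw : v ≠ w) (hvz : v ≠ z) (hwz : w ≠ z) (h : K.Reachable v w) : ¬ K.Reachable v z := by
  classical
  intro hr
  obtain ⟨p, hp⟩ := h.exists_isPath
  have hinj := hp.getVert_injOn
  have hlen : 0 < p.length := by
    rcases Nat.eq_zero_or_pos p.length with h0 | h0
    · exact absurd (Walk.eq_of_length_eq_zero h0) hvw
    · exact h0
  have hnb : ∀ n, 0 < n → n < p.length →
      K.Adj (p.getVert n) (p.getVert (n - 1)) ∧ K.Adj (p.getVert n) (p.getVert (n + 1)) ∧
        p.getVert (n - 1) ≠ p.getVert (n + 1) := by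
    intro n h0 hn
    refine ⟨?_, p.adj_getVert_succ hn, fun he => ?_⟩
    · have := p.adj_getVert_succ (i := n - 1) (by omega)
      rw [Nat.sub_add_cancel h0] at this
      exact this.symm
    · have := hinj (by simp; omega) (by simp; omega) he
      omega
  have hmem : z ∈ {y | ∃ n, n ≤ p.length ∧ p.getVert n = y} := by
    refine mem_of_reachable_of_closed ?_ ⟨0, by omega, p.getVert_zero⟩ hr
    rintro _ ⟨n, hn, rfl⟩ q hq
    rcases Nat.eq_zero_or_pos n with rfl | h0
    · refine ⟨1, by omega, ?_⟩
      have h1 := p.adj_getVert_succ hlen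
      rw [p.getVert_zero] at h1 hq
      exact hv _ _ h1 hq
    rcases Nat.lt_or_ge n p.length with hn' | hn'
    · obtain ⟨h1, h2, h3⟩ := hnb n h0 hn'
      rcases hK _ _ _ _ h1 h2 hq with h | h | h
      · exact absurd h h3
      · exact ⟨n + 1, by omega, h⟩
      · exact ⟨n - 1, by omega, h⟩
    · obtain rfl : n = p.length := by omega
      refine ⟨p.length - 1, by omega, ?_⟩
      have h1 := p.adj_getVert_succ (i := p.length - 1) (by omega)
      rw [Nat.sub_add_cancel hlen] at h1
      rw [p.getVert_length] at h1 hq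
      exact hw _ _ h1.symm hq
  obtain ⟨n, hn, rfl⟩ := hmem
  have h0 : 0 < n := Nat.pos_of_ne_zero fun h => hvz (by rw [h, p.getVert_zero])
  have hn' : n < p.length := lt_of_le_of_ne hn fun h => hwz (by rw [h, p.getVert_length])
  obtain ⟨h1, h2, h3⟩ := hnb n h0 hn'
  exact h3 (hz _ _ h1 h2)

end Reachability

section Colorings

variable {V : Type*} {α : Type*}

/-- The subgraph of the edges colored `a` or `b`. -/
def bichromatic (H : SimpleGraph V) (c : Sym2 V → α) (a b : α) : SimpleGraph V where
  Adj x y := H.Adj x y ∧ (c s(x, y) = a ∨ c s(x, y) = b)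
  symm := ⟨fun x y h => ⟨h.1.symm, by rw [Sym2.eq_swap]; exact h.2⟩⟩
  loopless := ⟨fun x h => h.1.ne rfl⟩

/-- The graph obtained by deleting all edges at `d`. -/
def isolate (H : SimpleGraph V) (d : V) : SimpleGraph V where
  Adj x y := H.Adj x y ∧ x ≠ d ∧ y ≠ d
  symm := ⟨fun _ _ h => ⟨h.1.symm, h.2.2, h.2.1⟩⟩
  loopless := ⟨fun _ h => h.1.ne rfl⟩

/-- An acyclic edge coloring, phrased with bichromatic subgraphs. -/
structure IsForestColoring (H : SimpleGraph V) (c : Sym2 V → α) : Prop where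
  proper : ∀ x y z, H.Adj x y → H.Adj x z → c s(x, y) = c s(x, z) → y = z
  acyclic : ∀ a b, (bichromatic H c a b).IsAcyclic

lemma isAcyclicEdgeColoring_iff {H : SimpleGraph V} {c : Sym2 V → α} :
    IsAcyclicEdgeColoring H c ↔ IsForestColoring H c := by
  constructor
  · rintro ⟨h1, h2⟩
    refine ⟨fun x y z hy hz h => ?_, fun a b v w hw => ?_⟩
    · by_contra hne
      exact h1 s(x, y) hy s(x, z) hz (fun he => hne (Sym2.congr_right.mp he))
        ⟨x, by simp, by simp⟩ h
    · have hle : bichromatic H c a b ≤ H := fun _ _ h => h.1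
      refine h2 v (w.mapLe hle) (hw.mapLe hle) ⟨a, b, fun e he => ?_⟩
      rw [Walk.edges_mapLe_eq_edges] at he
      have := Walk.edges_subset_edgeSet w he
      induction e with
      | h x y => exact this.2
  · rintro ⟨h1, h2⟩
    refine ⟨fun e₁ he₁ e₂ he₂ hne ⟨v, hv₁, hv₂⟩ h => ?_, fun v w hw ⟨a, b, hab⟩ => ?_⟩
    · obtain ⟨y, rfl⟩ := hv₁
      obtain ⟨z, rfl⟩ := hv₂
      exact hne (by rw [h1 v y z he₁ he₂ h])
    · have hp : ∀ e ∈ w.edges, e ∈ (bichromatic H c a b).edgeSet := by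
        intro e he
        have h1 := Walk.edges_subset_edgeSet w he
        have h2 := hab e he
        induction e with
        | h x y => exact ⟨h1, h2⟩
      exact h2 a b (w.transfer _ hp) (hw.transfer hp)

lemma IsForestColoring.congr {H' H : SimpleGraph V} {c c' : Sym2 V → α} (hle : H' ≤ H)
    (hc : IsForestColoring H c) (h : ∀ x y, H'.Adj x y → c' s(x, y) = c s(x, y)) :
    IsForestColoring H' c' := by
  refine ⟨fun x y z hy hz he => hc.proper x y z (hle hy) (hle hz) ?_, fun a b => ?_⟩
  · rwa [h _ _ hy, h _ _ hz] at he
  · refine (hc.acyclic a b).anti ?_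
    intro x y hxy
    refine ⟨hle hxy.1, ?_⟩
    rw [← h _ _ hxy.1]
    exact hxy.2

lemma isolate_le (H : SimpleGraph V) (d : V) : isolate H d ≤ H := fun _ _ h => h.1

lemma IsForestColoring.three_bichromatic {H : SimpleGraph V} {c : Sym2 V → α}
    (hc : IsForestColoring H c) {a b : α} (x p q r : V) (hp : (bichromatic H c a b).Adj x p)
    (hq : (bichromatic H c a b).Adj x q) (hr : (bichromatic H c a b).Adj x r) :
    p = q ∨ q = r ∨ p = r := by
  have h1 := hc.proper x p q hp.1 hq.1
  have h2 := hc.proper x q r hq.1 hr.1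
  have h3 := hc.proper x p r hp.1 hr.1
  have hp := hp.2
  have hq := hq.2
  have hr := hr.2
  grind

lemma bichromatic_comm (H : SimpleGraph V) (c : Sym2 V → α) (a b : α) :
    bichromatic H c a b = bichromatic H c b a := by
  ext x y
  simp only [bichromatic]
  tauto

/-- A color does not occur on the edges at `x`. -/
def IsMissing (H : SimpleGraph V) (c : Sym2 V → α) (x : V) (a : α) : Prop :=
  ∀ z, H.Adj x z → c s(x, z) ≠ a

lemma IsForestColoring.isLeafLike_of_isMissing {H : SimpleGraph V} {c : Sym2 V → α}
    (hc : IsForestColoring H c) {x : V} {a b : α} (ha : IsMissing H c x a) :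
    IsLeafLike (bichromatic H c a b) x := by
  intro p q hp hq
  have h1 := ha p hp.1
  have h2 := ha q hq.1
  have hp2 := hp.2
  have hq2 := hq.2
  exact hc.proper x p q hp.1 hq.1 (by grind)

/-- The first two edges of a bichromatic path joining two vertices that miss one color each. -/
lemma IsForestColoring.exists_two_steps {H : SimpleGraph V} {c : Sym2 V → α}
    (hc : IsForestColoring H c) {v w : V} {a g : α} (hvw : v ≠ w) (hg : IsMissing H c v g)
    (ha : IsMissing H c w a) (h : (bichromatic H c a g).Reachable v w) :
    ∃ y z, H.Adj v y ∧ c s(v, y) = a ∧ H.Adj y z ∧ c s(y, z) = g := by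
  classical
  obtain ⟨p, hp⟩ := h.exists_isPath
  cases p with
  | nil => exact absurd rfl hvw
  | @cons _ y _ h1 p =>
    have hy : c s(v, y) = a := h1.2.resolve_right (hg y h1.1)
    rw [Walk.cons_isPath_iff] at hp
    cases p with
    | nil =>
      exact absurd (by rwa [Sym2.eq_swap]) (ha v h1.1.symm)
    | @cons _ z _ h2 p =>
      refine ⟨y, z, h1.1, hy, h2.1, h2.2.resolve_left fun h => hp.2 ?_⟩
      have : v = z := hc.proper y v z h1.1.symm h2.1 (by rw [h, ← hy, Sym2.eq_swap])
      simp [this]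

/-- Extending an acyclic edge coloring to the two edges at a vertex of degree two. -/
lemma IsForestColoring.extend {H : SimpleGraph V} {c c' : Sym2 V → α} {d v w : V} {b g : α}
    (hdv : H.Adj d v) (hdw : H.Adj d w) (hvw : v ≠ w) (hd : ∀ z, H.Adj d z → z = v ∨ z = w)
    (hc : IsForestColoring (isolate H d) c) (hbg : b ≠ g)
    (hg : IsMissing (isolate H d) c v g) (hb : IsMissing (isolate H d) c w b)
    (hr : ¬ (bichromatic (isolate H d) c b g).Reachable v w)
    (h1 : c' s(d, v) = g) (h2 : c' s(d, w) = b)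
    (h3 : ∀ x y, x ≠ d → y ≠ d → c' s(x, y) = c s(x, y)) : IsForestColoring H c' := by
  have hprop : ∀ x y, x ≠ d → H.Adj x y → H.Adj x d → c' s(x, y) = c' s(x, d) → y = d := by
    intro x y hx hy hxd he
    by_contra hyd
    rw [h3 x y hx hyd] at he
    rcases hd x hxd.symm with rfl | rfl
    · exact hg y ⟨hy, hx, hyd⟩ (by rw [he, Sym2.eq_swap, h1])
    · exact hb y ⟨hy, hx, hyd⟩ (by rw [he, Sym2.eq_swap, h2])
  refine ⟨fun x y z hy hz he => ?_, fun p q => ?_⟩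
  · by_cases hx : x = d
    · subst hx
      rcases hd y hy with rfl | rfl <;> rcases hd z hz with rfl | rfl <;> grind
    · by_cases hyd : y = d
      · subst hyd
        exact (hprop x z hx hz hy he.symm).symm
      by_cases hzd : z = d
      · subst hzd
        exact hprop x y hx hy hz he
      rw [h3 x y hx hyd, h3 x z hx hzd] at he
      exact hc.proper x y z ⟨hy, hx, hyd⟩ ⟨hz, hx, hzd⟩ he
  · have hK := hc.acyclic p q
    set K := bichromatic (isolate H d) c p q with hKdef
    have hKd : ∀ z, z ≠ d → ¬ K.Reachable z d := by
      intro z hz h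
      have : d ∈ {y | y ≠ d} :=
        by
        refine mem_of_reachable_of_closed ?_ hz h
        intro x _ y hxy
        exact hxy.1.2.2
      exact this rfl
    have hbase : ∀ x y, x ≠ d → y ≠ d → (bichromatic H c' p q).Adj x y → K.Adj x y := by
      intro x y hx hy h
      refine ⟨⟨h.1, hx, hy⟩, ?_⟩
      rw [← h3 x y hx hy]
      exact h.2
    by_cases hgm : g = p ∨ g = q
    · by_cases hbm : b = p ∨ b = q
      · have hKbg : K = bichromatic (isolate H d) c b g := by
          rcases hgm with rfl | rfl <;> rcases hbm with rfl | rfl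
          · exact absurd rfl hbg
          · exact bichromatic_comm _ _ _ _
          · rfl
          · exact absurd rfl hbg
        rw [← hKbg] at hr
        have hK' := hK.sup_edge_of_not_reachable (hKd v hdv.ne')
        refine (hK'.sup_edge_of_not_reachable (u := d) (v := w) ?_).anti ?_
        · intro h
          have : w ∈ {z | K.Reachable v z ∨ z = d} := by
            refine mem_of_reachable_of_closed ?_ (Or.inr rfl) h
            rintro x hx y (hxy | hxy)
            · left
              rcases hx with hx | rfl
              · exact hx.trans hxy.reachable
              · exact absurd rfl hxy.1.2.1
            · rw [edge_adj] at hxy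
              rcases hxy.1 with ⟨rfl, rfl⟩ | ⟨rfl, rfl⟩
              · exact Or.inr rfl
              · exact Or.inl (Reachable.refl _)
          rcases this with h | h
          · exact hr h
          · exact hdw.ne' h
        · intro x y hxy
          by_cases hx : x = d
          · subst hx
            rcases hd y hxy.1 with rfl | rfl
            · exact Or.inl (Or.inr ((edge_adj ..).2 ⟨by simp, hxy.ne⟩))
            · exact Or.inr ((edge_adj ..).2 ⟨by simp, hxy.ne⟩)
          by_cases hy : y = d
          · subst hy
            rcases hd x hxy.1.symm with rfl | rfl
            · exact Or.inl (Or.inr ((edge_adj ..).2 ⟨by simp, hxy.ne⟩))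
            · exact Or.inr ((edge_adj ..).2 ⟨by simp, hxy.ne⟩)
          exact Or.inl (Or.inl (hbase x y hx hy hxy))
      · refine (hK.sup_edge_of_not_reachable (hKd v hdv.ne')).anti ?_
        intro x y hxy
        by_cases hx : x = d
        · subst hx
          rcases hd y hxy.1 with rfl | rfl
          · exact Or.inr ((edge_adj ..).2 ⟨by simp, hxy.ne⟩)
          · have := hxy.2
            grind
        by_cases hy : y = d
        · subst hy
          rcases hd x hxy.1.symm with rfl | rfl
          · exact Or.inr ((edge_adj ..).2 ⟨by simp, hxy.ne⟩)
          · have := hxy.2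
            rw [Sym2.eq_swap] at this
            grind
        exact Or.inl (hbase x y hx hy hxy)
    · refine (hK.sup_edge_of_not_reachable (hKd w hdw.ne')).anti ?_
      intro x y hxy
      by_cases hx : x = d
      · subst hx
        rcases hd y hxy.1 with rfl | rfl
        · have := hxy.2
          grind
        · exact Or.inr ((edge_adj ..).2 ⟨by simp, hxy.ne⟩)
      by_cases hy : y = d
      · subst hy
        rcases hd x hxy.1.symm with rfl | rfl
        · have := hxy.2
          rw [Sym2.eq_swap] at this
          grind
        · exact Or.inr ((edge_adj ..).2 ⟨by simp, hxy.ne⟩)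
      exact Or.inl (hbase x y hx hy hxy)

end Colorings

section CriticalStar

variable {V : Type*} {α : Type*} {H : SimpleGraph V} {v w : V} {X : Finset V}

/-- The situation around a vertex `v` in `H = G - u`, where `G` is critical and `u` is a vertex of
degree two with neighbors `v` and `w`: the neighbors of `v` outside `X` have degree two, and every
acyclic edge coloring of `H` is obstructed from extending to the edges at `u`. -/
structure IsCriticalStar (α : Type*) (H : SimpleGraph V) (v w : V) (X : Finset V) : Prop where
  ne : v ≠ w
  adj : ∀ x ∈ X, H.Adj v x
  reachable : ∀ c : Sym2 V → α, IsForestColoring H c → ∀ a g, a ≠ g → IsMissing H c w a →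
    IsMissing H c v g → (bichromatic H c a g).Reachable v w
  missing_iff : ∀ c : Sym2 V → α, IsForestColoring H c → ∀ a,
    IsMissing H c w a ↔ ∃ x ∈ X, c s(v, x) = a
  exists_missing : ∀ c : Sym2 V → α, IsForestColoring H c → ∀ s : Finset α, s.card ≤ 2 →
    ∃ g ∉ s, IsMissing H c v g
  pendant : ∀ d, H.Adj v d → d ∉ X →
    d ≠ w ∧ ∃ e, e ≠ v ∧ H.Adj d e ∧ ∀ z, H.Adj d z → z = v ∨ z = e
  saturated : ∀ c : Sym2 V → α, IsForestColoring H c → ∀ x ∈ X,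
    (∀ a, ¬ IsMissing H c w a → ∃ z, H.Adj x z ∧ c s(x, z) = a) →
      ∀ a, IsMissing H c w a → a ≠ c s(v, x) → IsMissing H c x a
  exists_missing_end : ∀ c : Sym2 V → α, IsForestColoring H c → ∀ d e, H.Adj d e →
    ∀ s : Finset α, s.card ≤ 2 → ∃ b ∉ s, IsMissing (isolate H d) c e b

namespace IsCriticalStar

variable {c : Sym2 V → α}

lemma color_isMissing (S : IsCriticalStar α H v w X) (hc : IsForestColoring H c) {x : V}
    (hx : x ∈ X) : IsMissing H c w (c s(v, x)) :=
  (S.missing_iff c hc _).2 ⟨x, hx, rfl⟩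

lemma eq_of_pendant (S : IsCriticalStar α H v w X) {d e z : V} (hvd : H.Adj v d) (hdX : d ∉ X)
    (hde : H.Adj d e) (hev : e ≠ v) (hz : H.Adj d z) : z = v ∨ z = e := by
  obtain ⟨-, e', -, -, h⟩ := S.pendant d hvd hdX
  obtain rfl := (h e hde).resolve_left hev
  exact h z hz

/-- The edges at a neighbor of `v` of degree two can be recolored with a prescribed color on the
edge not incident with `v`. -/
lemma recolor [DecidableEq V] (S : IsCriticalStar α H v w X)
    (hc : IsForestColoring H c) {d e : V} {b : α} (hvd : H.Adj v d) (hdX : d ∉ X)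
    (hde : H.Adj d e) (hev : e ≠ v) (hb : IsMissing (isolate H d) c e b)
    (h : ¬ IsMissing H c w b ∨ c s(d, e) = b ∨ e ≠ w) :
    ∃ g, IsMissing H c v g ∧ g ≠ b ∧
      IsForestColoring H (Function.update (Function.update c s(d, v) g) s(d, e) b) := by
  classical
  have hd : ∀ z, H.Adj d z → z = v ∨ z = e := fun z => S.eq_of_pendant hvd hdX hde hev
  have hc' : IsForestColoring (isolate H d) c := hc.congr (isolate_le H d) fun _ _ _ => rfl
  suffices hs : ∃ g, IsMissing H c v g ∧ g ≠ b ∧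
      ¬ (bichromatic (isolate H d) c b g).Reachable v e by
    obtain ⟨g, hg, hgb, hr⟩ := hs
    refine ⟨g, hg, hgb, hc'.extend hvd.symm hde hev.symm hd hgb.symm
      (fun z hz => hg z hz.1) hb hr ?_ ?_ ?_⟩
    · rw [Function.update_of_ne, Function.update_self]
      exact fun h => hev (Sym2.congr_right.mp h).symm
    · rw [Function.update_self]
    · intro x y hx hy
      rw [Function.update_of_ne, Function.update_of_ne]
      · intro h
        rcases Sym2.eq_iff.mp h with h | h
        exacts [hx h.1, hy h.2]
      · intro h
        rcases Sym2.eq_iff.mp h with h | h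
        exacts [hx h.1, hy h.2]
  by_cases hbw : IsMissing H c w b
  · obtain ⟨g, hgb, hg⟩ := S.exists_missing c hc {b} (by simp)
    have hgb : g ≠ b := by simpa using hgb
    refine ⟨g, hg, hgb, fun hr => ?_⟩
    have hre : (bichromatic H c b g).Reachable v e :=
      hr.mono (by
        intro x y hxy
        exact ⟨hxy.1.1, hxy.2⟩)
    have hvw := S.reachable c hc b g hgb.symm hbw hg
    have lv : IsLeafLike (bichromatic H c b g) v := by
      rw [bichromatic_comm]
      exact hc.isLeafLike_of_isMissing hg
    have lw : IsLeafLike (bichromatic H c b g) w := hc.isLeafLike_of_isMissing hbw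
    by_cases hcb : c s(d, e) = b
    · have ld : IsLeafLike (bichromatic H c b g) d := by
        have key : ∀ z, (bichromatic H c b g).Adj d z → z = e := by
          intro z hz
          rcases hd z hz.1 with rfl | rfl
          · rcases hz.2 with h | h
            · exact hc.proper d _ _ hz.1 hde (h.trans hcb.symm)
            · rw [Sym2.eq_swap] at h
              exact absurd h (hg d hvd)
          · rfl
        intro p q hp hq
        rw [key p hp, key q hq]
      refine not_reachable_third_leaf hc.three_bichromatic lv lw ld S.ne hvd.ne
        (S.pendant d hvd hdX).1.symm hvw (hre.trans (Adj.reachable ?_))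
      exact ⟨hde.symm, Or.inl (by rw [Sym2.eq_swap]; exact hcb)⟩
    · have le : IsLeafLike (bichromatic H c b g) e := by
        refine hc.isLeafLike_of_isMissing fun z hz hzb => ?_
        by_cases hzd : z = d
        · subst hzd
          rw [Sym2.eq_swap] at hzb
          exact hcb hzb
        · exact hb z ⟨hz, hde.ne', hzd⟩ hzb
      have hew : e ≠ w := (h.resolve_left (not_not.2 hbw)).resolve_left hcb
      exact not_reachable_third_leaf hc.three_bichromatic lv lw le S.ne hev.symm
        hew.symm hvw hre
  · by_cases hbv : IsMissing H c v b
    · obtain ⟨g, hgb, hg⟩ := S.exists_missing c hc {b} (by simp)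
      refine ⟨g, hg, by simpa using hgb, fun hr => hev ?_⟩
      have : e ∈ ({v} : Set V) := by
        refine mem_of_reachable_of_closed ?_ rfl hr
        rintro _ rfl q hq
        rcases hq.2 with h | h
        · exact absurd h (hbv q hq.1.1)
        · exact absurd h (hg q hq.1.1)
      exact this
    · simp only [IsMissing, not_forall, not_not] at hbv
      obtain ⟨y, hvy, hyb⟩ := hbv
      have hyX : y ∉ X := fun hy => hbw (hyb ▸ S.color_isMissing hc hy)
      obtain ⟨-, y', hy'v, hyy', hyn⟩ := S.pendant y hvy hyX
      obtain ⟨g, hgs, hg⟩ := S.exists_missing c hc {b, c s(y, y')} Finset.card_le_two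
      simp only [Finset.mem_insert, Finset.mem_singleton, not_or] at hgs
      refine ⟨g, hg, hgs.1, fun hr => ?_⟩
      have hy'b : c s(y, y') ≠ b := fun h => hy'v
        (hc.proper y _ _ hyy' hvy.symm (by rw [h, ← hyb, Sym2.eq_swap]))
      have : e ∈ ({v, y} : Set V) := by
        refine mem_of_reachable_of_closed ?_ (Or.inl rfl) hr
        rintro _ (rfl | rfl) q hq
        · rcases hq.2 with h | h
          · exact Or.inr (hc.proper _ _ _ hq.1.1 hvy (h.trans hyb.symm))
          · exact absurd h (hg q hq.1.1)
        · rcases hyn q hq.1.1 with rfl | rfl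
          · exact Or.inl rfl
          · rcases hq.2 with h | h
            · exact absurd h hy'b
            · exact absurd h.symm hgs.2
      rcases this with rfl | rfl
      · exact hev rfl
      · exact hb v ⟨hvy.symm, hde.ne', hvd.ne⟩ (by rw [Sym2.eq_swap]; exact hyb)

/-- At a neighbor of `v` in `X`, every color present at `w` is present. -/
lemma exists_color [DecidableEq V] (S : IsCriticalStar α H v w X)
    (hc : IsForestColoring H c) {x : V} (hx : x ∈ X) {a : α} (ha : ¬ IsMissing H c w a) :
    ∃ z, H.Adj x z ∧ c s(x, z) = a := by
  have key : ∀ c : Sym2 V → α, IsForestColoring H c → IsMissing H c v a → a ≠ c s(v, x) →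
      ∃ z, H.Adj x z ∧ c s(x, z) = a := by
    intro c hc hav hne
    have hm := S.color_isMissing hc hx
    obtain ⟨y, z, hy, hyc, hz, hzc⟩ := hc.exists_two_steps S.ne hav hm
      (S.reachable c hc _ _ hne.symm hm hav)
    obtain rfl := hc.proper v _ _ hy (S.adj x hx) hyc
    exact ⟨z, hz, hzc⟩
  by_cases hav : IsMissing H c v a
  · exact key c hc hav fun h => hav x (S.adj x hx) h.symm
  · simp only [IsMissing, not_forall, not_not] at hav
    obtain ⟨d, hvd, hda⟩ := hav
    have hdX : d ∉ X := fun h => ha (hda ▸ S.color_isMissing hc h)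
    obtain ⟨-, e, hev, hde, hd⟩ := S.pendant d hvd hdX
    have hb : IsMissing (isolate H d) c e (c s(d, e)) := by
      intro z hz h
      exact hz.2.2 (hc.proper e _ _ hz.1 hde.symm (by rw [h, Sym2.eq_swap]))
    obtain ⟨g, hg, hgb, hc'⟩ := S.recolor hc hvd hdX hde hev hb (Or.inr (Or.inl rfl))
    have hupd : ∀ f, f ≠ s(d, v) →
        Function.update (Function.update c s(d, v) g) s(d, e) (c s(d, e)) f = c f := by
      intro f hf
      by_cases hf' : f = s(d, e)
      · rw [hf', Function.update_self]
      · rw [Function.update_of_ne hf', Function.update_of_ne hf]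
    have hdv : Function.update (Function.update c s(d, v) g) s(d, e) (c s(d, e)) s(d, v) = g := by
      rw [Function.update_of_ne, Function.update_self]
      exact fun h => hev (Sym2.congr_right.mp h).symm
    generalize Function.update (Function.update c s(d, v) g) s(d, e) (c s(d, e)) = c' at *
    have hxd : x ≠ d := fun h => hdX (h ▸ hx)
    have hxv : x ≠ v := (S.adj x hx).ne'
    obtain ⟨z, hz, hza⟩ := key c' hc' (by
      intro z hz h
      by_cases hzd : z = d
      · subst hzd
        rw [Sym2.eq_swap, hdv] at h
        subst h
        exact hg _ hvd hda
      · rw [hupd] at h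
        · exact hzd (hc.proper v _ _ hz hvd (h.trans hda.symm))
        · intro he
          rcases Sym2.eq_iff.mp he with h | h
          exacts [hvd.ne h.1, hzd h.2]) (by
      rw [hupd]
      · intro h
        exact ha (h ▸ S.color_isMissing hc hx)
      · intro he
        rcases Sym2.eq_iff.mp he with h | h
        exacts [hvd.ne h.1, hxd h.2])
    refine ⟨z, hz, ?_⟩
    rwa [hupd] at hza
    intro he
    rcases Sym2.eq_iff.mp he with h | h
    exacts [hxd h.1, hxv h.1]

lemma isMissing_of_mem [DecidableEq V] (S : IsCriticalStar α H v w X)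
    (hc : IsForestColoring H c) {x : V} (hx : x ∈ X) {a : α} (ha : IsMissing H c w a)
    (hax : a ≠ c s(v, x)) : IsMissing H c x a :=
  S.saturated c hc x hx (fun _ h => S.exists_color hc hx h) a ha hax

/-- Two colors on the edges from `v` to `X` can be kept away from the far edges at the other
neighbors of `v`. -/
lemma exists_avoiding [Fintype V] [DecidableEq V] (S : IsCriticalStar α H v w X) {x₁ x₂ : V}
    (h₁ : x₁ ∈ X) (h₂ : x₂ ∈ X) (hc : IsForestColoring H c) :
    ∃ c : Sym2 V → α, IsForestColoring H c ∧ ∀ d e, H.Adj v d → d ∉ X → H.Adj d e → e ≠ v →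
      c s(d, e) ≠ c s(v, x₁) ∧ c s(d, e) ≠ c s(v, x₂) := by
  classical
  let P (c : Sym2 V → α) : Finset V := Finset.univ.filter fun d =>
    H.Adj v d ∧ d ∉ X ∧ ∃ e, H.Adj d e ∧ e ≠ v ∧ (c s(d, e) = c s(v, x₁) ∨ c s(d, e) = c s(v, x₂))
  suffices hs : ∀ n, ∀ c : Sym2 V → α, IsForestColoring H c → (P c).card ≤ n →
      ∃ c : Sym2 V → α, IsForestColoring H c ∧ P c = ∅ by
    obtain ⟨c', hc', hP⟩ := hs _ c hc le_rfl
    refine ⟨c', hc', fun d e hvd hdX hde hev => ?_⟩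
    have : d ∉ P c' := by simp [hP]
    simp only [P, Finset.mem_filter, Finset.mem_univ, true_and] at this
    by_contra hcon
    exact this ⟨hvd, hdX, e, hde, hev, by tauto⟩
  intro n
  induction n with
  | zero => exact fun c hc h => ⟨c, hc, by simpa using h⟩
  | succ n ih =>
    intro c hc hn
    rcases (P c).eq_empty_or_nonempty with h0 | ⟨d, hdP⟩
    · exact ⟨c, hc, h0⟩
    have hdP' := hdP
    simp only [P, Finset.mem_filter, Finset.mem_univ, true_and] at hdP'
    obtain ⟨hvd, hdX, e, hde, hev, hcol⟩ := hdP'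
    obtain ⟨b, hbs, hb⟩ := S.exists_missing_end c hc d e hde {c s(v, x₁), c s(v, x₂)}
      Finset.card_le_two
    simp only [Finset.mem_insert, Finset.mem_singleton, not_or] at hbs
    have hew : e ≠ w := by
      rintro rfl
      have hm : IsMissing H c e (c s(d, e)) := by
        rcases hcol with h | h
        · exact h ▸ S.color_isMissing hc h₁
        · exact h ▸ S.color_isMissing hc h₂
      exact hm d hde.symm (by rw [Sym2.eq_swap])
    obtain ⟨g, hg, -, hc'⟩ := S.recolor hc hvd hdX hde hev hb (Or.inr (Or.inr hew))
    have hde' : Function.update (Function.update c s(d, v) g) s(d, e) b s(d, e) = b :=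
      Function.update_self ..
    have hupd : ∀ f, f ≠ s(d, v) → f ≠ s(d, e) →
        Function.update (Function.update c s(d, v) g) s(d, e) b f = c f := by
      intro f hf hf'
      rw [Function.update_of_ne hf', Function.update_of_ne hf]
    generalize Function.update (Function.update c s(d, v) g) s(d, e) b = c' at *
    have hX : ∀ x ∈ X, c' s(v, x) = c s(v, x) := by
      intro x hx
      have hxd : x ≠ d := fun h => hdX (h ▸ hx)
      refine hupd _ (fun he => ?_) fun he => ?_
      · rcases Sym2.eq_iff.mp he with h | h
        exacts [hvd.ne h.1, hxd h.2]
      · rcases Sym2.eq_iff.mp he with h | h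
        exacts [hvd.ne h.1, hxd h.2]
    refine ih c' hc' (Nat.lt_succ_iff.mp (lt_of_lt_of_le (Finset.card_lt_card ?_) hn))
    rw [Finset.ssubset_iff_of_subset]
    · refine ⟨d, hdP, ?_⟩
      simp only [P, Finset.mem_filter, Finset.mem_univ, true_and, hX x₁ h₁, hX x₂ h₂]
      rintro ⟨-, -, e', hde₂, hev₂, hcol₂⟩
      obtain rfl := (S.eq_of_pendant hvd hdX hde hev hde₂).resolve_left hev₂
      rw [hde'] at hcol₂
      tauto
    · intro d' hd'
      simp only [P, Finset.mem_filter, Finset.mem_univ, true_and, hX x₁ h₁, hX x₂ h₂] at hd' ⊢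
      obtain ⟨hvd₂, hdX₂, e', hde₂, hev₂, hcol₂⟩ := hd'
      refine ⟨hvd₂, hdX₂, e', hde₂, hev₂, ?_⟩
      rwa [hupd] at hcol₂
      · intro he
        rcases Sym2.eq_iff.mp he with h | h
        exacts [hev₂ h.2, hvd₂.ne h.1.symm]
      · intro he
        rw [he, hde'] at hcol₂
        tauto

/-- Exchange of two colors on the edges at `v`. -/
def swapAt [DecidableEq V] [DecidableEq α] (c : Sym2 V → α) (v : V) (a b : α) : Sym2 V → α :=
  fun e => if v ∈ e then Equiv.swap a b (c e) else c e

section Swap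

variable [DecidableEq V] [DecidableEq α]

lemma swapAt_of_mem (v z : V) (a b : α) : swapAt c v a b s(v, z) = Equiv.swap a b (c s(v, z)) :=
  if_pos (by simp)

lemma swapAt_of_ne {v x z : V} (a b : α) (hx : x ≠ v) (hz : z ≠ v) :
    swapAt c v a b s(x, z) = c s(x, z) :=
  if_neg (by simp [hx.symm, hz.symm])

lemma swapAt_apply_eq_iff {a b i : α} (hia : i ≠ a) (hib : i ≠ b) (e : Sym2 V) :
    swapAt c v a b e = i ↔ c e = i := by
  unfold swapAt
  split_ifs
  · rw [← Equiv.eq_symm_apply, Equiv.symm_swap, Equiv.swap_apply_of_ne_of_ne hia hib]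
  · rfl

lemma swapAt_apply_eq_or_iff {a b : α} (e : Sym2 V) :
    (swapAt c v a b e = a ∨ swapAt c v a b e = b) ↔ (c e = a ∨ c e = b) := by
  unfold swapAt
  split_ifs
  · rw [← Equiv.eq_symm_apply, ← Equiv.eq_symm_apply, Equiv.symm_swap,
      Equiv.swap_apply_left, Equiv.swap_apply_right, or_comm]
  · rfl

lemma swap_acyclic_mixed (S : IsCriticalStar α H v w X) {x₁ x₂ : V}
    (h₁ : x₁ ∈ X) (h₂ : x₂ ∈ X) (h₁₂ : x₁ ≠ x₂) (hc : IsForestColoring H c)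
    (hav : ∀ d e, H.Adj v d → d ∉ X → H.Adj d e → e ≠ v → c s(d, e) ≠ c s(v, x₁))
    {b : α} (hb₁ : b ≠ c s(v, x₁)) (hb₂ : b ≠ c s(v, x₂)) :
    (bichromatic H (swapAt c v (c s(v, x₁)) (c s(v, x₂))) (c s(v, x₁)) b).IsAcyclic := by
  set a₁ := c s(v, x₁) with ha₁
  set a₂ := c s(v, x₂) with ha₂
  set c' := swapAt c v a₁ a₂ with hc'
  have hsw : ∀ e, c' e = b ↔ c e = b := swapAt_apply_eq_iff hb₁ hb₂
  have hva : ∀ z, H.Adj v z → c' s(v, z) = a₁ → z = x₂ := by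
    intro z hz h
    rw [hc', swapAt_of_mem, ← Equiv.eq_symm_apply, Equiv.symm_swap,
      Equiv.swap_apply_left] at h
    exact hc.proper v _ _ hz (S.adj _ h₂) h
  let K : SimpleGraph V :=
    { Adj := fun p q => (bichromatic H c' a₁ b).Adj p q ∧ s(p, q) ≠ s(v, x₂)
      symm := ⟨fun p q h => ⟨h.1.symm, by rw [Sym2.eq_swap]; exact h.2⟩⟩
      loopless := ⟨fun p h => h.1.ne rfl⟩ }
  have hKv : ∀ z, K.Adj v z → c s(v, z) = b := by
    intro z hz
    rcases hz.1.2 with h | h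
    · obtain rfl := hva z hz.1.1 h
      exact absurd rfl hz.2
    · exact (hsw _).1 h
  have hKne : ∀ p q, p ≠ v → q ≠ v → K.Adj p q → c s(p, q) = a₁ ∨ c s(p, q) = b := by
    intro p q hp hq h
    have := h.1.2
    rwa [hc', swapAt_of_ne a₁ a₂ hp hq] at this
  have hKle : K ≤ bichromatic H c a₁ b := by
    intro p q h
    refine ⟨h.1.1, ?_⟩
    by_cases hp : p = v
    · subst hp
      exact Or.inr (hKv _ h)
    by_cases hq : q = v
    · subst hq
      rw [Sym2.eq_swap]
      exact Or.inr (hKv _ h.symm)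
    exact hKne p q hp hq h
  have hx₂v : x₂ ≠ v := (S.adj _ h₂).ne'
  have hr : ¬ K.Reachable v x₂ := by
    intro hr
    by_cases hbw : IsMissing H c w b
    · have : x₂ ∈ {z | z ≠ x₂} := by
        refine mem_of_reachable_of_closed ?_ hx₂v.symm hr
        rintro p - q hpq rfl
        by_cases hp : p = v
        · subst hp
          exact hpq.2 rfl
        · have := hKne _ _ hx₂v hp hpq.symm
          rcases this with h | h
          · refine S.isMissing_of_mem hc h₂ (S.color_isMissing hc h₁) (fun he => h₁₂ ?_) p
              hpq.symm.1.1 h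
            exact hc.proper v _ _ (S.adj _ h₁) (S.adj _ h₂) he
          · exact S.isMissing_of_mem hc h₂ hbw hb₂ p hpq.symm.1.1 h
      exact this rfl
    · have : x₂ ∈ {z | z = v ∨ (H.Adj v z ∧ c s(v, z) = b)} := by
        refine mem_of_reachable_of_closed ?_ (Or.inl rfl) hr
        rintro p (rfl | ⟨hvp, hpb⟩) q hq
        · exact Or.inr ⟨hq.1.1, hKv q hq⟩
        · by_cases hqv : q = v
          · exact Or.inl hqv
          have hpX : p ∉ X := fun h => hbw (hpb ▸ S.color_isMissing hc h)
          rcases hKne p q hvp.ne' hqv hq with h | h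
          · exact absurd h (hav p q hvp hpX hq.1.1 hqv)
          · exact absurd (hc.proper p _ _ hq.1.1 hvp.symm
              (by rw [h, ← hpb, Sym2.eq_swap])) hqv
      rcases this with h | h
      · exact hx₂v h
      · exact hb₂ h.2.symm
  refine (((hc.acyclic a₁ b).anti hKle).sup_edge_of_not_reachable hr).anti ?_
  intro p q hpq
  by_cases he : s(p, q) = s(v, x₂)
  · exact Or.inr ((edge_adj ..).2 ⟨Sym2.eq_iff.mp he, hpq.ne⟩)
  · exact Or.inl ⟨hpq, he⟩

lemma isForestColoring_swapAt (S : IsCriticalStar α H v w X) {x₁ x₂ : V}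
    (h₁ : x₁ ∈ X) (h₂ : x₂ ∈ X) (h₁₂ : x₁ ≠ x₂) (hc : IsForestColoring H c)
    (hav : ∀ d e, H.Adj v d → d ∉ X → H.Adj d e → e ≠ v →
      c s(d, e) ≠ c s(v, x₁) ∧ c s(d, e) ≠ c s(v, x₂)) :
    IsForestColoring H (swapAt c v (c s(v, x₁)) (c s(v, x₂))) := by
  have hne : c s(v, x₁) ≠ c s(v, x₂) := fun h =>
    h₁₂ (hc.proper v _ _ (S.adj _ h₁) (S.adj _ h₂) h)
  have hm₁ : IsMissing H c x₁ (c s(v, x₂)) :=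
    S.isMissing_of_mem hc h₁ (S.color_isMissing hc h₂) hne.symm
  have hm₂ : IsMissing H c x₂ (c s(v, x₁)) :=
    S.isMissing_of_mem hc h₂ (S.color_isMissing hc h₁) hne
  have hmix₁ : ∀ b, b ≠ c s(v, x₁) → b ≠ c s(v, x₂) →
      (bichromatic H (swapAt c v (c s(v, x₁)) (c s(v, x₂))) (c s(v, x₁)) b).IsAcyclic :=
    fun b => S.swap_acyclic_mixed h₁ h₂ h₁₂ hc fun d e h h' h'' h''' => (hav d e h h' h'' h''').1
  have hmix₂ : ∀ b, b ≠ c s(v, x₁) → b ≠ c s(v, x₂) →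
      (bichromatic H (swapAt c v (c s(v, x₁)) (c s(v, x₂))) (c s(v, x₂)) b).IsAcyclic := by
    intro b hb₁ hb₂
    have hcomm : swapAt c v (c s(v, x₁)) (c s(v, x₂)) = swapAt c v (c s(v, x₂)) (c s(v, x₁)) := by
      unfold swapAt
      rw [Equiv.swap_comm]
    rw [hcomm]
    exact S.swap_acyclic_mixed h₂ h₁ h₁₂.symm hc
      (fun d e h h' h'' h''' => (hav d e h h' h'' h''').2) hb₂ hb₁
  have hx₁ : ∀ z, H.Adj v z → c s(v, z) = c s(v, x₁) → z = x₁ := fun z hz h =>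
    hc.proper v _ _ hz (S.adj _ h₁) h
  have hx₂ : ∀ z, H.Adj v z → c s(v, z) = c s(v, x₂) → z = x₂ := fun z hz h =>
    hc.proper v _ _ hz (S.adj _ h₂) h
  generalize c s(v, x₁) = a₁ at *
  generalize c s(v, x₂) = a₂ at *
  have hprop : ∀ x z, x ≠ v → z ≠ v → H.Adj x v → H.Adj x z →
      swapAt c v a₁ a₂ s(x, v) ≠ swapAt c v a₁ a₂ s(x, z) := by
    intro x z hx hz hxv hxz he
    rw [Sym2.eq_swap, swapAt_of_mem, swapAt_of_ne a₁ a₂ hx hz] at he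
    by_cases e₁ : c s(v, x) = a₁
    · obtain rfl := hx₁ x hxv.symm e₁
      rw [e₁, Equiv.swap_apply_left] at he
      exact hm₁ z hxz he.symm
    by_cases e₂ : c s(v, x) = a₂
    · obtain rfl := hx₂ x hxv.symm e₂
      rw [e₂, Equiv.swap_apply_right] at he
      exact hm₂ z hxz he.symm
    rw [Equiv.swap_apply_of_ne_of_ne e₁ e₂, Sym2.eq_swap] at he
    exact hz (hc.proper x _ _ hxv hxz he).symm
  refine ⟨fun x y z hy hz he => ?_, fun a b => ?_⟩
  · by_cases hx : x = v
    · subst hx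
      rw [swapAt_of_mem, swapAt_of_mem] at he
      exact hc.proper x _ _ hy hz ((Equiv.swap a₁ a₂).injective he)
    · by_cases hyv : y = v
      · subst hyv
        by_contra hzy
        exact hprop x z hx (Ne.symm hzy) hy hz he
      by_cases hzv : z = v
      · subst hzv
        exact absurd he.symm (hprop x y hx hyv hz hy)
      rw [swapAt_of_ne a₁ a₂ hx hyv, swapAt_of_ne a₁ a₂ hx hzv] at he
      exact hc.proper x _ _ hy hz he
  · by_cases ha : a = a₁ ∨ a = a₂
    · by_cases hb : b = a₁ ∨ b = a₂
      · refine (hc.acyclic a₁ a₂).anti ?_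
        intro p q hpq
        refine ⟨hpq.1, (swapAt_apply_eq_or_iff (v := v) _).1 ?_⟩
        have := hpq.2
        grind
      · rcases ha with rfl | rfl
        · exact hmix₁ b (fun h => hb (Or.inl h)) fun h => hb (Or.inr h)
        · exact hmix₂ b (fun h => hb (Or.inl h)) fun h => hb (Or.inr h)
    · have ha₁ : a ≠ a₁ := fun h => ha (Or.inl h)
      have ha₂ : a ≠ a₂ := fun h => ha (Or.inr h)
      by_cases hb : b = a₁ ∨ b = a₂
      · rw [bichromatic_comm]
        rcases hb with rfl | rfl
        · exact hmix₁ a ha₁ ha₂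
        · exact hmix₂ a ha₁ ha₂
      · have hb₁ : b ≠ a₁ := fun h => hb (Or.inl h)
        have hb₂ : b ≠ a₂ := fun h => hb (Or.inr h)
        refine (hc.acyclic a b).anti ?_
        intro p q hpq
        refine ⟨hpq.1, ?_⟩
        rw [← swapAt_apply_eq_iff (v := v) ha₁ ha₂, ← swapAt_apply_eq_iff (v := v) hb₁ hb₂]
        exact hpq.2

end Swap

lemma not_isForestColoring [Fintype V] (S : IsCriticalStar α H v w X) {x₁ x₂ : V}
    (h₁ : x₁ ∈ X) (h₂ : x₂ ∈ X) (h₁₂ : x₁ ≠ x₂) (c : Sym2 V → α) : ¬ IsForestColoring H c := by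
  classical
  intro hc
  obtain ⟨c, hc, hav⟩ := S.exists_avoiding h₁ h₂ hc
  have hc' := S.isForestColoring_swapAt h₁ h₂ h₁₂ hc hav
  have hne : c s(v, x₁) ≠ c s(v, x₂) := fun h =>
    h₁₂ (hc.proper v _ _ (S.adj _ h₁) (S.adj _ h₂) h)
  have hm₁ : IsMissing H c x₁ (c s(v, x₂)) :=
    S.isMissing_of_mem hc h₁ (S.color_isMissing hc h₂) hne.symm
  have hw₁ := S.color_isMissing hc h₁
  have hw₂ := S.color_isMissing hc h₂
  have hx₁ : ∀ z, H.Adj v z → c s(v, z) = c s(v, x₁) → z = x₁ := fun z hz h =>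
    hc.proper v _ _ hz (S.adj _ h₁) h
  have hx₁v : x₁ ≠ v := (S.adj _ h₁).ne'
  have hx₁w : x₁ ≠ w := by
    rintro rfl
    exact hw₁ v (S.adj _ h₁).symm (by rw [Sym2.eq_swap])
  obtain ⟨g, hgs, hg⟩ := S.exists_missing c hc {c s(v, x₁), c s(v, x₂)} Finset.card_le_two
  simp only [Finset.mem_insert, Finset.mem_singleton, not_or] at hgs
  obtain ⟨hg₁, hg₂⟩ := hgs
  have hK := S.reachable c hc _ g (Ne.symm hg₁) hw₁ hg
  generalize hga₁ : c s(v, x₁) = a₁ at *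
  generalize c s(v, x₂) = a₂ at *
  set c' := swapAt c v a₁ a₂ with hcc'
  have hsw : ∀ e, c' e = g ↔ c e = g := swapAt_apply_eq_iff hg₁ hg₂
  have hg' : IsMissing H c' v g := fun z hz h => hg z hz ((hsw _).1 h)
  have hw' : IsMissing H c' w a₁ := by
    intro z hz h
    have := (swapAt_apply_eq_or_iff (c := c) (v := v) (a := a₁) (b := a₂) s(w, z)).1 (Or.inl h)
    rcases this with h | h
    exacts [hw₁ z hz h, hw₂ z hz h]
  have hK' := S.reachable c' hc' a₁ g (Ne.symm hg₁) hw' hg'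
  have hm' : IsMissing H c' x₁ a₁ := by
    intro z hz h
    by_cases hzv : z = v
    · subst hzv
      rw [Sym2.eq_swap, hcc', swapAt_of_mem, hga₁, Equiv.swap_apply_left] at h
      exact hne h.symm
    · rw [hcc', swapAt_of_ne a₁ a₂ hx₁v hzv] at h
      refine hzv (hc.proper x₁ _ _ hz (S.adj _ h₁).symm ?_)
      rw [h, ← hga₁, Sym2.eq_swap]
  have hx₁w' : (bichromatic H c' a₁ g).Reachable x₁ w := by
    have : w ∈ {z | z = v ∨ (bichromatic H c' a₁ g).Reachable x₁ z} := by
      refine mem_of_reachable_of_closed ?_ (Or.inl rfl) hK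
      have hstep : ∀ q, (bichromatic H c a₁ g).Adj v q → q = x₁ := fun q hq =>
        hx₁ q hq.1 (hq.2.resolve_right (hg q hq.1))
      rintro p hp q hq
      by_cases hpv : p = v
      · subst hpv
        rw [hstep q hq]
        exact Or.inr (Reachable.refl _)
      by_cases hqv : q = v
      · exact Or.inl hqv
      refine Or.inr ((hp.resolve_left hpv).trans (Adj.reachable ⟨hq.1, ?_⟩))
      rw [hcc', swapAt_of_ne a₁ a₂ hpv hqv]
      exact hq.2
    exact this.resolve_left S.ne.symm
  refine not_reachable_third_leaf hc'.three_bichromatic (hc'.isLeafLike_of_isMissing hw')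
    (hc'.isLeafLike_of_isMissing hm') ?_ hx₁w.symm S.ne.symm hx₁v hx₁w'.symm hK'.symm
  rw [bichromatic_comm]
  exact hc'.isLeafLike_of_isMissing hg'

end IsCriticalStar

end CriticalStar

section Counting

variable {V : Type*} {α : Type*} [Fintype α] {H : SimpleGraph V} {c : Sym2 V → α}

open Classical in
lemma card_le_card_missing_add {x : V} {N : Finset V} (hN : ∀ z, H.Adj x z → z ∈ N) :
    Fintype.card α ≤ (Finset.univ.filter (IsMissing H c x)).card + N.card := by
  have hsub : (Finset.univ : Finset α) ⊆
      Finset.univ.filter (IsMissing H c x) ∪ N.image fun z => c s(x, z) := by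
    intro a _
    by_cases ha : IsMissing H c x a
    · simp [ha]
    · simp only [IsMissing, not_forall, not_not] at ha
      obtain ⟨z, hz, hza⟩ := ha
      exact Finset.mem_union_right _ (Finset.mem_image.2 ⟨z, hN z hz, hza⟩)
  calc Fintype.card α ≤ _ := Finset.card_le_card hsub
    _ ≤ _ := (Finset.card_union_le _ _).trans (by gcongr; exact Finset.card_image_le)

lemma exists_isMissing_notMem {x : V} {N : Finset V} (hN : ∀ z, H.Adj x z → z ∈ N)
    {s : Finset α} (hs : s.card + N.card < Fintype.card α) : ∃ g ∉ s, IsMissing H c x g := by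
  classical
  have h := card_le_card_missing_add (c := c) hN
  obtain ⟨g, hg, hgs⟩ := Finset.exists_mem_notMem_of_card_lt_card
    (s := s) (t := Finset.univ.filter (IsMissing H c x)) (by omega)
  exact ⟨g, hgs, by simpa using hg⟩

end Counting

section Critical

variable {V : Type*} [Fintype V] {G : SimpleGraph V} [DecidableRel G.Adj]

lemma card_le_degree_of_colors {α : Type*} {c : Sym2 V → α} {x : V} {s : Finset α}
    (h : ∀ a ∈ s, ∃ z, G.Adj x z ∧ c s(x, z) = a) : s.card ≤ G.degree x := by
  classical
  refine (Finset.card_le_card (t := (G.neighborFinset x).image fun z => c s(x, z)) ?_).trans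
    Finset.card_image_le
  intro a ha
  obtain ⟨z, hz, hza⟩ := h a ha
  exact Finset.mem_image.2 ⟨z, by simpa using hz, hza⟩

lemma card_neighborFinset_erase_lt [DecidableEq V] {x d : V} (h : G.Adj x d) :
    ((G.neighborFinset x).erase d).card < G.maxDegree := by
  have h1 := G.degree_le_maxDegree x
  have h2 := Finset.card_erase_lt_of_mem ((G.mem_neighborFinset x d).2 h)
  rw [card_neighborFinset_eq_degree] at h2
  omega

lemma isCriticalStar_isolate [DecidableEq V]
    (hG : ¬ AcyclicEdgeColorable G (G.maxDegree + 2)) {u v w : V}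
    (huv : G.Adj u v) (huw : G.Adj u w) (hvw : v ≠ w) (hu : ∀ z, G.Adj u z → z = v ∨ z = w)
    (hdu : G.degree u = 2) (hv : 5 ≤ G.degree v)
    (hX : ((G.neighborFinset v).filter fun x => G.degree x ≠ 2).card ≤ 3)
    {c₀ : Sym2 V → Fin (G.maxDegree + 2)} (hc₀ : IsForestColoring (isolate G u) c₀) :
    IsCriticalStar (Fin (G.maxDegree + 2)) (isolate G u) v w
      ((G.neighborFinset v).filter fun x => G.degree x ≠ 2) ∧
    ((G.neighborFinset v).filter fun x => G.degree x ≠ 2).card = 3 := by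
  classical
  set X := (G.neighborFinset v).filter fun x => G.degree x ≠ 2 with hXdef
  have hadj : ∀ x ∈ X, (isolate G u).Adj v x := by
    intro x hx
    simp only [hXdef, Finset.mem_filter, mem_neighborFinset] at hx
    refine ⟨hx.1, huv.ne', ?_⟩
    rintro rfl
    exact hx.2 hdu
  have hreach : ∀ c : Sym2 V → Fin (G.maxDegree + 2), IsForestColoring (isolate G u) c →
      ∀ a g, a ≠ g → IsMissing (isolate G u) c w a → IsMissing (isolate G u) c v g →
        (bichromatic (isolate G u) c a g).Reachable v w := by
    intro c hc a g hag ha hg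
    by_contra hr
    refine hG ⟨Function.update (Function.update c s(u, v) g) s(u, w) a,
      isAcyclicEdgeColoring_iff.2 (hc.extend huv huw hvw hu hag hg ha hr ?_ ?_ ?_)⟩
    · rw [Function.update_of_ne, Function.update_self]
      exact fun h => hvw (Sym2.congr_right.mp h)
    · rw [Function.update_self]
    · intro x y hx hy
      rw [Function.update_of_ne, Function.update_of_ne]
      · intro h
        rcases Sym2.eq_iff.mp h with h | h
        exacts [hx h.1, hy h.2]
      · intro h
        rcases Sym2.eq_iff.mp h with h | h
        exacts [hx h.1, hy h.2]
  have hN : ∀ x z, (isolate G u).Adj x z → z ∈ (G.neighborFinset x).erase u := by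
    intro x z h
    simpa using ⟨h.2.2, h.1⟩
  have hNv := card_neighborFinset_erase_lt huv.symm
  have hNw := card_neighborFinset_erase_lt huw.symm
  have hvmiss : ∀ c : Sym2 V → Fin (G.maxDegree + 2), ∀ s : Finset (Fin (G.maxDegree + 2)),
      s.card ≤ 2 → ∃ g ∉ s, IsMissing (isolate G u) c v g := fun c s hs =>
    exists_isMissing_notMem (hN v) (by rw [Fintype.card_fin]; omega)
  have hmem : ∀ c : Sym2 V → Fin (G.maxDegree + 2), IsForestColoring (isolate G u) c →
      ∀ a, IsMissing (isolate G u) c w a → ∃ x ∈ X, c s(v, x) = a := by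
    intro c hc a ha
    obtain ⟨g₀, hg₀, hg₀v⟩ := hvmiss c {a} (by simp)
    obtain ⟨y, z₀, hy, hya, -, -⟩ := hc.exists_two_steps hvw hg₀v ha
      (hreach c hc a g₀ (by simpa [eq_comm] using hg₀) ha hg₀v)
    have hav : ¬ IsMissing (isolate G u) c v a := fun h => h y hy hya
    refine ⟨y, ?_, hya⟩
    have hcard := card_le_degree_of_colors (G := G) (c := c) (x := y)
      (s := insert a (Finset.univ.filter (IsMissing (isolate G u) c v))) (by
        intro g hg
        rw [Finset.mem_insert] at hg
        rcases hg with rfl | hg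
        · exact ⟨v, hy.1.symm, by rw [Sym2.eq_swap]; exact hya⟩
        · have hg : IsMissing (isolate G u) c v g := by simpa using hg
          have hag : a ≠ g := fun h => hav (h ▸ hg)
          obtain ⟨y', z, hy', hya', hz, hzg⟩ := hc.exists_two_steps hvw hg ha
            (hreach c hc a g hag ha hg)
          obtain rfl := hc.proper v _ _ hy hy' (hya.trans hya'.symm)
          exact ⟨z, hz.1, hzg⟩)
    rw [Finset.card_insert_of_notMem (by simpa using hav)] at hcard
    have h2 := card_le_card_missing_add (c := c) (hN v)
    rw [Fintype.card_fin] at h2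
    simp only [hXdef, Finset.mem_filter, mem_neighborFinset]
    exact ⟨hy.1, by omega⟩
  have hcount : ∀ c : Sym2 V → Fin (G.maxDegree + 2), IsForestColoring (isolate G u) c →
      (Finset.univ.filter (IsMissing (isolate G u) c w)) = X.image (fun x => c s(v, x)) ∧
        X.card = 3 ∧ (Finset.univ.filter (IsMissing (isolate G u) c w)).card = 3 ∧
        G.maxDegree ≤ G.degree w := by
    intro c hc
    have hsub : Finset.univ.filter (IsMissing (isolate G u) c w) ⊆
        X.image (fun x => c s(v, x)) := by
      intro a ha
      rw [Finset.mem_image]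
      exact hmem c hc a (by simpa using ha)
    have h1 := Finset.card_le_card hsub
    have h2 : (X.image (fun x => c s(v, x))).card ≤ X.card := Finset.card_image_le
    have h3 := card_le_card_missing_add (c := c) (hN w)
    have h4 := Finset.card_erase_add_one ((G.mem_neighborFinset w u).2 huw.symm)
    rw [card_neighborFinset_eq_degree] at h4
    rw [Fintype.card_fin] at h3
    exact ⟨Finset.eq_of_subset_of_card_le hsub (by omega), by omega, by omega, by omega⟩
  have hiff : ∀ c : Sym2 V → Fin (G.maxDegree + 2), IsForestColoring (isolate G u) c →
      ∀ a, IsMissing (isolate G u) c w a ↔ ∃ x ∈ X, c s(v, x) = a := by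
    intro c hc a
    have := Finset.ext_iff.1 (hcount c hc).1 a
    simpa using this
  have hdw : 5 ≤ G.degree w :=
    hv.trans ((G.degree_le_maxDegree v).trans (hcount c₀ hc₀).2.2.2)
  refine ⟨⟨hvw, hadj, hreach, hiff, fun c _ => hvmiss c, ?_, ?_, ?_⟩, (hcount c₀ hc₀).2.1⟩
  · intro d hvd hdX
    have hd2 : G.degree d = 2 := by
      by_contra h
      exact hdX (by simpa [hXdef] using ⟨hvd.1, h⟩)
    have hdw' : d ≠ w := by
      rintro rfl
      omega
    refine ⟨hdw', ?_⟩
    rw [← card_neighborFinset_eq_degree, Finset.card_eq_two] at hd2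
    obtain ⟨p, q, hpq, hd⟩ := hd2
    have hnb : ∀ z, G.Adj d z ↔ z = p ∨ z = q := by
      intro z
      rw [← mem_neighborFinset, hd]
      simp
    have hud : ¬ G.Adj d u := by
      intro h
      rcases hu d h.symm with rfl | rfl
      exacts [hvd.ne rfl, hdw' rfl]
    have hadj' : ∀ z, (isolate G u).Adj d z ↔ G.Adj d z := by
      refine fun z => ⟨fun h => h.1, fun h => ⟨h, hvd.2.2, ?_⟩⟩
      rintro rfl
      exact hud h
    simp only [hadj', hnb]
    rcases (hnb v).1 hvd.1.symm with rfl | rfl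
    · exact ⟨q, hpq.symm, Or.inr rfl, fun z h => h⟩
    · exact ⟨p, hpq, Or.inl rfl, fun z h => h.symm⟩
  · intro c hc x hx hsat a ha hax z hz hza
    obtain ⟨-, -, h3, -⟩ := hcount c hc
    set A := Finset.univ.filter (IsMissing (isolate G u) c w) with hA
    have haA : a ∈ A := by simpa [hA] using ha
    have hxA : c s(v, x) ∈ A := by simpa [hA] using (hiff c hc _).2 ⟨x, hx, rfl⟩
    have hcard := card_le_degree_of_colors (G := G) (c := c) (x := x)
      (s := insert a (insert (c s(v, x)) Aᶜ)) (by
        intro b hb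
        simp only [Finset.mem_insert, Finset.mem_compl] at hb
        rcases hb with rfl | rfl | hb
        · exact ⟨z, hz.1, hza⟩
        · exact ⟨v, (hadj x hx).1.symm, by rw [Sym2.eq_swap]⟩
        · obtain ⟨y, hy, hyb⟩ := hsat b (by simpa [hA] using hb)
          exact ⟨y, hy.1, hyb⟩)
    rw [Finset.card_insert_of_notMem (by simp [hax, haA]),
      Finset.card_insert_of_notMem (by simp [hxA]), Finset.card_compl, Fintype.card_fin] at hcard
    have := G.degree_le_maxDegree x
    have := G.degree_le_maxDegree v
    omega
  · intro c _ d e hde s hs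
    have hlt := card_neighborFinset_erase_lt hde.1.symm
    refine exists_isMissing_notMem (N := (G.neighborFinset e).erase d) (fun z hz => ?_)
      (by rw [Fintype.card_fin]; omega)
    simpa using ⟨hz.2.2, hz.1.1⟩

end Critical

theorem stmt14 {V : Type*} [Fintype V] [DecidableEq V] (G : SimpleGraph V) [DecidableRel G.Adj]
    (hG : IsAcyclicallyEdgeCritical G (G.maxDegree + 2))
    (v : V) (t : ℕ) (hv : G.degree v = t) (ht : 5 ≤ t) :
    ((G.neighborFinset v).filter fun w => G.degree w = 2).card ≤ t - 4 := by
  classical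
  by_contra hcon
  have hsum := Finset.card_filter_add_card_filter_not (s := G.neighborFinset v)
    (fun w => G.degree w = 2)
  rw [card_neighborFinset_eq_degree, hv] at hsum
  obtain ⟨u, hu⟩ := Finset.card_pos.1 (Nat.zero_lt_of_lt (not_le.1 hcon))
  simp only [Finset.mem_filter, mem_neighborFinset] at hu
  obtain ⟨hvu, hdu⟩ := hu
  obtain ⟨p, q, hpq, hN⟩ := Finset.card_eq_two.1 (G.card_neighborFinset_eq_degree u ▸ hdu)
  have hnb : ∀ z, G.Adj u z ↔ z = p ∨ z = q := by
    intro z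
    rw [← mem_neighborFinset, hN]
    simp
  obtain ⟨w, hvw, huw, hu⟩ : ∃ w, v ≠ w ∧ G.Adj u w ∧ ∀ z, G.Adj u z → z = v ∨ z = w := by
    rcases (hnb v).1 hvu.symm with rfl | rfl
    · exact ⟨q, hpq, (hnb q).2 (Or.inr rfl), fun z h => (hnb z).1 h⟩
    · exact ⟨p, hpq.symm, (hnb p).2 (Or.inl rfl), fun z h => ((hnb z).1 h).symm⟩
  have hlt : isolate G u < G := by
    refine lt_of_le_of_ne (isolate_le G u) fun h => ?_
    have : (isolate G u).Adj v u := by rw [h]; exact hvu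
    exact this.2.2 rfl
  obtain ⟨c, hc⟩ := hG.2 _ hlt
  rw [isAcyclicEdgeColoring_iff] at hc
  obtain ⟨S, hcard⟩ := isCriticalStar_isolate hG.1 hvu.symm huw hvw hu hdu (by omega)
    (by simp only [ne_eq]; omega) hc
  obtain ⟨x₁, h₁, x₂, h₂, h₁₂⟩ := Finset.one_lt_card.1 (by rw [hcard]; norm_num)
  exact S.not_isForestColoring h₁ h₂ h₁₂ c hc
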